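/- Let q and α be real numbers with 0 < q < 1 and α > 0. Then there exists a constant C > 0 (depending only on q and α) such that for every L ≥ 0, every L-Lipschitz function f : ℝ → ℝ, every positive integer n, and every x ∈ ℝ: |K_n(f; x) − f(x)| ≤ C·L/n. -/

import Mathlib

/-- The generalized hyperbolic tangent activation function. -/
noncomputable def h (q α x : ℝ) : ℝ :=
  (Real.exp (α * x) - q * Real.exp (-(α * x))) /
    ((1 + q) * Real.exp (α * x) + (1 - q) * Real.exp (-(α * x)))

/-- The associated density function. -/
noncomputable def ψ (q α x : ℝ) : ℝ :=
  ((1 - q ^ 2) / (2 * (1 + q ^ 2))) * (h q α (x + 1) - h q α (x - 1))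

/-- The quasi-interpolation neural network operator. -/
noncomputable def A (q α : ℝ) (n : ℕ) (f : ℝ → ℝ) (x : ℝ) : ℝ :=
  ∑' k : ℤ, f (k / n) * ψ q α (n * x - k)

/-- The Kantorovich-type neural network operator. -/
noncomputable def K (q α : ℝ) (n : ℕ) (f : ℝ → ℝ) (x : ℝ) : ℝ :=
  ∑' k : ℤ, ((n : ℝ) * ∫ t in ((k : ℝ) / n)..(((k : ℝ) + 1) / n), f t) * ψ q α (n * x - k)

/-- The logistic function whose symmetric difference is the density `ψ`. -/
noncomputable def logistic (q α x : ℝ) : ℝ :=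
  1 - (1 - q) / ((1 + q) * Real.exp (2 * α * x) + (1 - q))

section

variable {q α : ℝ}

theorem logistic_denom_pos (hq0 : 0 < q) (hq1 : q < 1) (x : ℝ) :
    0 < (1 + q) * Real.exp (2 * α * x) + (1 - q) := by
  have := Real.exp_pos (2 * α * x)
  have : 0 < 1 - q := by linarith
  positivity

theorem h_eq_logistic (hq0 : 0 < q) (hq1 : q < 1) (x : ℝ) :
    h q α x = 1 / (1 + q) - (1 + q ^ 2) / (1 - q ^ 2) * (1 - logistic q α x) := by
  have hE : Real.exp (2 * α * x) = Real.exp (α * x) * Real.exp (α * x) := by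
    rw [← Real.exp_add]; ring_nf
  have hd := logistic_denom_pos (α := α) hq0 hq1 x
  have h1 : (1 - q) ≠ 0 := by linarith
  have h2 : (1 + q) ≠ 0 := by linarith
  have hx := Real.exp_pos (α * x)
  unfold h logistic
  rw [hE] at hd ⊢
  rw [Real.exp_neg]
  rw [show (1 + q) * Real.exp (α * x) + (1 - q) * (Real.exp (α * x))⁻¹ =
      ((1 + q) * (Real.exp (α * x) * Real.exp (α * x)) + (1 - q)) / Real.exp (α * x) by
    field_simp, show 1 - q ^ 2 = (1 - q) * (1 + q) by ring]
  have hd2 := hd.ne'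
  generalize Real.exp (α * x) = e at *
  have hx' := hx.ne'
  rw [div_div_eq_mul_div, sub_sub_cancel, div_mul_div_comm, div_sub_div _ _ h2 (by positivity),
    div_eq_div_iff hd2 (by positivity)]
  field_simp
  ring

theorem ψ_eq_logistic (hq0 : 0 < q) (hq1 : q < 1) (x : ℝ) :
    ψ q α x = (logistic q α (x + 1) - logistic q α (x - 1)) / 2 := by
  have h3 : (1 - q ^ 2) ≠ 0 := by nlinarith
  have h4 : (1 + q ^ 2) ≠ 0 := by positivity
  rw [ψ, h_eq_logistic hq0 hq1, h_eq_logistic hq0 hq1]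
  field_simp
  ring

theorem logistic_monotone (hq0 : 0 < q) (hq1 : q < 1) (hα : 0 < α) :
    Monotone (logistic q α) := by
  intro x y hxy
  have := logistic_denom_pos (α := α) hq0 hq1 x
  have : 0 ≤ 1 - q := by linarith
  unfold logistic
  gcongr

theorem logistic_nonneg (hq0 : 0 < q) (hq1 : q < 1) (x : ℝ) : 0 ≤ logistic q α x := by
  rw [logistic, sub_nonneg, div_le_one (logistic_denom_pos hq0 hq1 x)]
  have := Real.exp_pos (2 * α * x)
  have : 0 < (1 + q) * Real.exp (2 * α * x) := by positivity
  linarith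

theorem logistic_le_one (hq0 : 0 < q) (hq1 : q < 1) (x : ℝ) : logistic q α x ≤ 1 := by
  rw [logistic, sub_le_self_iff]
  exact div_nonneg (by linarith) (logistic_denom_pos hq0 hq1 x).le

theorem logistic_le_exp (hq0 : 0 < q) (hq1 : q < 1) (x : ℝ) :
    logistic q α x ≤ (1 + q) / (1 - q) * Real.exp (2 * α * x) := by
  have hd := logistic_denom_pos (α := α) hq0 hq1 x
  have h1 : 0 < 1 - q := by linarith
  have hx := Real.exp_pos (2 * α * x)
  rw [logistic, one_sub_div hd.ne', add_sub_cancel_right, div_mul_eq_mul_div]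
  gcongr
  have : 0 < (1 + q) * Real.exp (2 * α * x) := by positivity
  linarith

theorem one_sub_logistic_le_exp (hq0 : 0 < q) (hq1 : q < 1) (x : ℝ) :
    1 - logistic q α x ≤ (1 + q) / (1 - q) * Real.exp (-(2 * α * x)) := by
  have hd := logistic_denom_pos (α := α) hq0 hq1 x
  have h1 : 0 < 1 - q := by linarith
  have hx := Real.exp_pos (2 * α * x)
  rw [logistic, sub_sub_cancel, Real.exp_neg, ← div_eq_mul_inv, div_div]
  gcongr
  · linarith
  · nlinarith

theorem tendsto_logistic_atTop (hq0 : 0 < q) (hq1 : q < 1) (hα : 0 < α) :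
    Filter.Tendsto (logistic q α) Filter.atTop (nhds 1) := by
  have h0 : Filter.Tendsto (fun x => 1 - (1 + q) / (1 - q) * Real.exp (-(2 * α * x)))
      Filter.atTop (nhds (1 - (1 + q) / (1 - q) * 0)) :=
    ((Real.tendsto_exp_neg_atTop_nhds_zero.comp
      (Filter.tendsto_id.const_mul_atTop (by positivity))).const_mul _).const_sub _
  rw [mul_zero, sub_zero] at h0
  exact tendsto_of_tendsto_of_tendsto_of_le_of_le h0 tendsto_const_nhds
    (fun x => by have := one_sub_logistic_le_exp (α := α) hq0 hq1 x; linarith)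
    (logistic_le_one hq0 hq1)

theorem tendsto_logistic_atBot (hq0 : 0 < q) (hq1 : q < 1) (hα : 0 < α) :
    Filter.Tendsto (logistic q α) Filter.atBot (nhds 0) := by
  have h0 : Filter.Tendsto (fun x => (1 + q) / (1 - q) * Real.exp (2 * α * x))
      Filter.atBot (nhds ((1 + q) / (1 - q) * 0)) :=
    (Real.tendsto_exp_atBot.comp
      (Filter.tendsto_id.const_mul_atBot (by positivity))).const_mul _
  rw [mul_zero] at h0
  exact tendsto_of_tendsto_of_tendsto_of_le_of_le tendsto_const_nhds h0
    (logistic_nonneg hq0 hq1) (logistic_le_exp hq0 hq1)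

theorem ψ_nonneg (hq0 : 0 < q) (hq1 : q < 1) (hα : 0 < α) (x : ℝ) : 0 ≤ ψ q α x := by
  rw [ψ_eq_logistic hq0 hq1]
  have := logistic_monotone hq0 hq1 hα (show x - 1 ≤ x + 1 by linarith)
  linarith

theorem ψ_le_exp (hq0 : 0 < q) (hq1 : q < 1) (x : ℝ) :
    ψ q α x ≤ (1 + q) / (1 - q) * Real.exp (2 * α * (1 - |x|)) := by
  have hr : 0 < (1 + q) / (1 - q) := div_pos (by linarith) (by linarith)
  have hpos := mul_pos hr (Real.exp_pos (2 * α * (1 - |x|)))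
  rw [ψ_eq_logistic hq0 hq1]
  rcases le_total 0 x with hx | hx
  · have h1 := one_sub_logistic_le_exp (α := α) hq0 hq1 (x - 1)
    have h2 := logistic_le_one (α := α) hq0 hq1 (x + 1)
    rw [abs_of_nonneg hx] at hpos ⊢
    rw [show -(2 * α * (x - 1)) = 2 * α * (1 - x) by ring] at h1
    linarith
  · have h1 := logistic_le_exp (α := α) hq0 hq1 (x + 1)
    have h2 := logistic_nonneg (α := α) hq0 hq1 (x - 1)
    rw [abs_of_nonpos hx] at hpos ⊢
    rw [show 2 * α * (x + 1) = 2 * α * (1 - -x) by ring] at h1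
    linarith

theorem hasSum_ψ (hq0 : 0 < q) (hq1 : q < 1) (hα : 0 < α) (y : ℝ) :
    HasSum (fun k : ℤ => ψ q α (y - k)) 1 := by
  set u : ℝ → ℝ := fun x => (logistic q α x + logistic q α (x + 1)) / 2 with hu
  have hψ (x : ℝ) : ψ q α x = u x - u (x - 1) := by
    simp only [ψ_eq_logistic hq0 hq1, hu, sub_add_cancel]
    ring
  have hbot : Filter.Tendsto u Filter.atBot (nhds 0) := by
    have := tendsto_logistic_atBot hq0 hq1 hα
    simpa using (this.add (this.comp
      (Filter.tendsto_atBot_add_const_right _ 1 Filter.tendsto_id))).div_const 2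
  have htop : Filter.Tendsto u Filter.atTop (nhds 1) := by
    have := tendsto_logistic_atTop hq0 hq1 hα
    simpa using (this.add (this.comp
      (Filter.tendsto_atTop_add_const_right _ 1 Filter.tendsto_id))).div_const 2
  have hpos : HasSum (fun k : ℕ => ψ q α (y - ((k : ℤ) : ℝ))) (u y - 0) := by
    rw [hasSum_iff_tendsto_nat_of_nonneg (fun _ => ψ_nonneg hq0 hq1 hα _)]
    have hs (m : ℕ) : ∑ k ∈ Finset.range m, ψ q α (y - ((k : ℤ) : ℝ)) = u y - u (y - m) := by
      have := Finset.sum_range_sub' (fun k : ℕ => u (y - k)) m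
      simpa [hψ, sub_sub] using this
    simp only [hs]
    refine (hbot.comp ?_).const_sub _
    exact Filter.tendsto_atBot_add_const_left _ y
      (Filter.tendsto_neg_atTop_atBot.comp tendsto_natCast_atTop_atTop)
  have hneg : HasSum (fun k : ℕ => ψ q α (y - ((-((k : ℤ) + 1) : ℤ) : ℝ))) (1 - u y) := by
    rw [hasSum_iff_tendsto_nat_of_nonneg (fun _ => ψ_nonneg hq0 hq1 hα _)]
    have hs (m : ℕ) : ∑ k ∈ Finset.range m, ψ q α (y - ((-((k : ℤ) + 1) : ℤ) : ℝ)) =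
        u (y + m) - u y := by
      have := Finset.sum_range_sub (fun k : ℕ => u (y + k)) m
      simp only [Nat.cast_zero, add_zero] at this
      rw [← this]
      refine Finset.sum_congr rfl fun k _ => ?_
      rw [hψ]
      push_cast
      congr 2 <;> ring
    simp only [hs]
    refine (htop.comp ?_).sub_const _
    exact Filter.tendsto_atTop_add_const_left _ y tendsto_natCast_atTop_atTop
  have hsum := HasSum.of_nat_of_neg_add_one (f := fun k : ℤ => ψ q α (y - k)) hpos hneg
  rwa [sub_zero, add_sub_cancel] at hsum

theorem summable_abs_add_two_mul_exp (hα : 0 < α) :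
    Summable fun k : ℤ => (|(k : ℝ)| + 2) * Real.exp (2 * α * (2 - |(k : ℝ)|)) := by
  have hN : Summable fun k : ℕ => ((k : ℝ) + 2) * Real.exp (2 * α * (2 - k)) := by
    have h1 := Real.summable_pow_mul_exp_neg_nat_mul 1 (r := 2 * α) (by positivity)
    have h0 := Real.summable_pow_mul_exp_neg_nat_mul 0 (r := 2 * α) (by positivity)
    refine ((h1.add (h0.mul_left 2)).mul_left (Real.exp (4 * α))).congr fun k => ?_
    rw [show 2 * α * (2 - (k : ℝ)) = 4 * α + -(2 * α) * k by ring, Real.exp_add]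
    ring
  refine Summable.of_nat_of_neg ?_ ?_ <;> simpa using hN

/-- A bound for the first absolute moment of the density, uniform in the base point. -/
theorem tsum_abs_add_one_mul_ψ_le (hq0 : 0 < q) (hq1 : q < 1) (hα : 0 < α) (y : ℝ) :
    Summable (fun k : ℤ => (|y - k| + 1) * ψ q α (y - k)) ∧
      ∑' k : ℤ, (|y - k| + 1) * ψ q α (y - k) ≤
        ∑' k : ℤ, (1 + q) / (1 - q) *
          ((|(k : ℝ)| + 2) * Real.exp (2 * α * (2 - |(k : ℝ)|))) := by
  have hr : 0 < (1 + q) / (1 - q) := div_pos (by linarith) (by linarith)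
  have hS := (summable_abs_add_two_mul_exp hα).mul_left ((1 + q) / (1 - q))
  let e : ℤ ≃ ℤ := Equiv.subLeft ⌊y⌋
  have hle (k : ℤ) : (|y - (e k : ℤ)| + 1) * ψ q α (y - (e k : ℤ)) ≤
      (1 + q) / (1 - q) * ((|(k : ℝ)| + 2) * Real.exp (2 * α * (2 - |(k : ℝ)|))) := by
    have hy : y - (e k : ℤ) = Int.fract y + k := by
      simp only [e, Equiv.subLeft_apply, Int.cast_sub, Int.fract]
      ring
    have hf0 := Int.fract_nonneg y
    have hf1 := Int.fract_lt_one y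
    rw [hy]
    have h1 : |Int.fract y + k| ≤ |(k : ℝ)| + 1 := by
      refine (abs_add_le _ _).trans ?_
      rw [abs_of_nonneg hf0]
      linarith
    have h2 : |(k : ℝ)| ≤ |Int.fract y + k| + 1 := by
      have := abs_sub (Int.fract y + k) (Int.fract y)
      rw [add_sub_cancel_left, abs_of_nonneg hf0] at this
      linarith
    calc (|Int.fract y + k| + 1) * ψ q α (Int.fract y + k)
        ≤ (|(k : ℝ)| + 2) * ((1 + q) / (1 - q) * Real.exp (2 * α * (2 - |(k : ℝ)|))) := by
          refine mul_le_mul (by linarith) ((ψ_le_exp hq0 hq1 _).trans ?_)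
            (ψ_nonneg hq0 hq1 hα _) (by positivity)
          gcongr _ * Real.exp (_ * ?_)
          linarith
      _ = _ := by ring
  have hsum : Summable (fun k : ℤ => (|y - (e k : ℤ)| + 1) * ψ q α (y - (e k : ℤ))) :=
    Summable.of_nonneg_of_le
      (fun k => mul_nonneg (by positivity) (ψ_nonneg hq0 hq1 hα _)) hle hS
  refine ⟨(e.summable_iff (f := fun k : ℤ => (|y - k| + 1) * ψ q α (y - k))).mp hsum, ?_⟩
  rw [← e.tsum_eq (fun k : ℤ => (|y - k| + 1) * ψ q α (y - k))]
  exact hsum.tsum_le_tsum hle hS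

end

/-- The mean of a Lipschitz function over a cell of the grid of step `1 / n`. -/
theorem abs_mean_sub_le {L : ℝ} (hL : 0 ≤ L) {f : ℝ → ℝ}
    (hf : LipschitzWith (Real.toNNReal L) f) {n : ℕ} (hn : 0 < n) (x : ℝ) (k : ℤ) :
    |(n : ℝ) * (∫ t in ((k : ℝ) / n)..(((k : ℝ) + 1) / n), f t) - f x| ≤
      L / n * (|n * x - k| + 1) := by
  have hn' : (0 : ℝ) < n := by exact_mod_cast hn
  have hlen : ((k : ℝ) + 1) / n - k / n = 1 / n := by ring
  have hab : (k : ℝ) / n ≤ ((k : ℝ) + 1) / n := by gcongr; linarith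
  have hI : ∫ t in ((k : ℝ) / n)..(((k : ℝ) + 1) / n), (f t - f x) =
      (∫ t in ((k : ℝ) / n)..(((k : ℝ) + 1) / n), f t) - 1 / n * f x := by
    rw [intervalIntegral.integral_sub (hf.continuous.intervalIntegrable _ _)
      intervalIntegrable_const, intervalIntegral.integral_const, hlen, smul_eq_mul]
  have hB : ∀ t ∈ Set.uIoc ((k : ℝ) / n) (((k : ℝ) + 1) / n),
      ‖f t - f x‖ ≤ L / n * (|n * x - k| + 1) := by
    intro t ht
    rw [Set.uIoc_of_le hab, Set.mem_Ioc, div_lt_iff₀ hn', le_div_iff₀ hn'] at ht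
    have h1 := hf.dist_le_mul t x
    rw [Real.coe_toNNReal L hL, Real.dist_eq, Real.dist_eq] at h1
    have h2 : n * |t - x| ≤ |n * x - k| + 1 := by
      rw [← abs_of_pos hn', ← abs_mul, abs_of_pos hn',
        show (n : ℝ) * (t - x) = (t * n - k) - (n * x - k) by ring]
      refine (abs_sub _ _).trans ?_
      rw [abs_of_pos (show 0 < t * n - k by linarith)]
      linarith
    calc ‖f t - f x‖ ≤ L * |t - x| := h1
      _ = L / n * (n * |t - x|) := by field_simp
      _ ≤ _ := by gcongr
  have h := intervalIntegral.norm_integral_le_of_norm_le_const hB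
  rw [hI, hlen, abs_of_pos (by positivity : (0 : ℝ) < 1 / n), Real.norm_eq_abs] at h
  calc |(n : ℝ) * (∫ t in ((k : ℝ) / n)..(((k : ℝ) + 1) / n), f t) - f x|
      = n * |(∫ t in ((k : ℝ) / n)..(((k : ℝ) + 1) / n), f t) - 1 / n * f x| := by
        rw [← abs_of_pos hn', ← abs_mul, abs_of_pos hn']
        congr 1
        field_simp
    _ ≤ n * (L / n * (|n * x - k| + 1) * (1 / n)) := by gcongr
    _ = _ := by field_simp

theorem kantorovich_lipschitz_rate (q α : ℝ) (hq0 : 0 < q) (hq1 : q < 1)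
    (hα : 0 < α) :
    ∃ C : ℝ, 0 < C ∧ ∀ L : ℝ, 0 ≤ L → ∀ f : ℝ → ℝ,
      LipschitzWith (Real.toNNReal L) f → ∀ n : ℕ, 0 < n → ∀ x : ℝ,
        |K q α n f x - f x| ≤ C * L / n := by
  have hr : 0 < (1 + q) / (1 - q) := div_pos (by linarith) (by linarith)
  refine ⟨∑' k : ℤ, (1 + q) / (1 - q) *
      ((|(k : ℝ)| + 2) * Real.exp (2 * α * (2 - |(k : ℝ)|))), ?_, ?_⟩
  · exact ((summable_abs_add_two_mul_exp hα).mul_left _).tsum_pos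
      (fun k => by positivity) 0 (by positivity)
  intro L hL f hf n hn x
  obtain ⟨hS, hT⟩ := tsum_abs_add_one_mul_ψ_le hq0 hq1 hα (n * x)
  have h1 := hasSum_ψ hq0 hq1 hα (n * x)
  set a : ℤ → ℝ := fun k => (n : ℝ) * ∫ t in ((k : ℝ) / n)..(((k : ℝ) + 1) / n), f t
  have hbound (k : ℤ) : ‖(a k - f x) * ψ q α (n * x - k)‖ ≤
      L / n * ((|n * x - k| + 1) * ψ q α (n * x - k)) := by
    have hψ := ψ_nonneg hq0 hq1 hα (n * x - k)
    rw [norm_mul, Real.norm_eq_abs, Real.norm_of_nonneg hψ, ← mul_assoc]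
    exact mul_le_mul_of_nonneg_right (abs_mean_sub_le hL hf hn x k) hψ
  have hD : Summable fun k : ℤ => (a k - f x) * ψ q α (n * x - k) :=
    Summable.of_norm_bounded (hS.mul_left (L / n)) hbound
  have hK : K q α n f x - f x = ∑' k : ℤ, (a k - f x) * ψ q α (n * x - k) := by
    have := (hD.hasSum.add (h1.mul_left (f x))).tsum_eq
    simp only [← add_mul, sub_add_cancel, mul_one] at this
    rw [K, this, add_sub_cancel_right]
  rw [hK, ← Real.norm_eq_abs]
  refine (tsum_of_norm_bounded (hS.mul_left (L / n)).hasSum hbound).trans ?_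
  rw [tsum_mul_left, mul_div_assoc, mul_comm]
  gcongr
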